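/- arXiv:2602.23631 — 4 statements merged into one kernel-verified Lean document; each statement's English description precedes it below -/
import Mathlib

section
/- Lemma (Lemma 2.5(2)). Let K ⊆ {1, …, n}, assume P is nondegenerate, and let F be a facet of P whose barycenter lies in C_K. Then for every s ∈ W_K, the intersection s(F) ∩ F is either equal to F (equivalently, s(F) = F) or empty. -/
open scoped RealInnerProductSpace

noncomputable section

variable {V : Type*} [NormedAddCommGroup V] [InnerProductSpace ℝ V]

/-- The reflection `r_α` across the hyperplane orthogonal to `α`:
`r_α(x) = x − (2⟪x,α⟫/⟪α,α⟫) α`. -/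
def reflMap (α : V) : V → V := fun x => x - (2 * ⟪x, α⟫ / ⟪α, α⟫) • α

/-- The hyperplane `H_α = {x | ⟪x, α⟫ = 0}` fixed by `reflMap α`. -/
def hplane (α : V) : Set V := {x : V | ⟪x, α⟫ = 0}

/-- `F` is a facet of the full-dimensional polytope `Q`: an exposed face whose affine
span has dimension `n − 1` (where `n = dim V`). -/
def IsFacet (Q F : Set V) : Prop :=
  IsExposed ℝ Q F ∧ Module.finrank ℝ (affineSpan ℝ F).direction + 1 = Module.finrank ℝ V

open Classical in
/-- The barycenter of a nonempty face: the centroid of its finitely many extreme points. -/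
def barycenter (F : Set V) : V :=
  if h : (Set.extremePoints ℝ F).Finite then h.toFinset.centroid ℝ id else 0

/-- A full-dimensional polytope is simple if every extreme point lies in exactly `n` facets. -/
def IsSimple (Q : Set V) : Prop :=
  ∀ v ∈ Set.extremePoints ℝ Q, {F : Set V | IsFacet Q F ∧ v ∈ F}.ncard = Module.finrank ℝ V

/-- The cone `C_K = {x | ⟪x, α_k⟫ ≥ 0 for all k ∈ K}`. -/
def cham {n : ℕ} (α : Fin n → V) (K : Set (Fin n)) : Set V :=
  {x : V | ∀ k ∈ K, 0 ≤ ⟪x, α k⟫}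

/-- The parabolic subgroup `W_K`, realized as the submonoid of `Function.End V`
generated by the simple reflections `r_{α_k}`, `k ∈ K` (since each generator is an
involution, this submonoid coincides with the generated group). -/
def WK {n : ℕ} (α : Fin n → V) (K : Set (Fin n)) : Submonoid (Function.End V) :=
  Submonoid.closure {g : Function.End V | ∃ k ∈ K, g = reflMap (α k)}

/-- A reduced root system of full rank `n` in `V` with a fixed simple system `α`. -/
structure RootSystemData (V : Type*) [NormedAddCommGroup V] [InnerProductSpace ℝ V]
    (n : ℕ) : Type _ where
  α : Fin n → V
  R : Set V
  hn : 1 ≤ n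
  hdim : Module.finrank ℝ V = n
  hR_fin : R.Finite
  hR_ne0 : ∀ β ∈ R, β ≠ 0
  hR_refl : ∀ β ∈ R, reflMap β '' R = R
  hR_red : ∀ β ∈ R, R ∩ {x : V | ∃ c : ℝ, x = c • β} = {β, -β}
  hα_mem : ∀ i, α i ∈ R
  hα_indep : LinearIndependent ℝ α
  hα_span : Submodule.span ℝ (Set.range α) = ⊤
  hα_sign : ∀ β ∈ R, ∃ c : Fin n → ℝ, β = ∑ i, c i • α i ∧
    ((∀ i, 0 ≤ c i) ∨ (∀ i, c i ≤ 0))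

/-- A `W`-symmetric polytope datum: a root system together with a finite nonempty
set `Λ` contained in the fundamental chamber `C_S`. -/
structure PermSetup (V : Type*) [NormedAddCommGroup V] [InnerProductSpace ℝ V]
    (n : ℕ) extends RootSystemData V n where
  Λ : Set V
  hΛ_fin : Λ.Finite
  hΛ_ne : Λ.Nonempty
  hΛ_cham : Λ ⊆ cham α Set.univ

/-- The `W`-symmetric polytope `P = conv(⋃_{w ∈ W} w(Λ))`. -/
def PermSetup.P {n : ℕ} (S : PermSetup V n) : Set V :=
  convexHull ℝ (⋃ w ∈ WK S.α Set.univ, Set.image w S.Λ)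

/-- `P` is nondegenerate: `⟪λ, α_i⟫ > 0` for every `λ ∈ Λ` and every `i`. -/
def PermSetup.Nondegenerate {n : ℕ} (S : PermSetup V n) : Prop :=
  ∀ l ∈ S.Λ, ∀ i, 0 < ⟪l, S.α i⟫

/-- The reflection across the hyperplane orthogonal to `a`, as a linear isometry. -/
def reflIso (a : V) : V ≃ₗᵢ[ℝ] V := (ℝ ∙ a)ᗮ.reflection

lemma reflIso_apply (a x : V) : reflIso a x = x - (2 * ⟪x, a⟫ / ⟪a, a⟫) • a := by
  rw [reflIso, Submodule.reflection_orthogonal_apply, Submodule.reflection_singleton_apply,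
    real_inner_self_eq_norm_sq, real_inner_comm]
  simp only [RCLike.ofReal_real_eq_id, id_eq, neg_sub, sub_right_inj]
  rw [mul_div_assoc, mul_smul, two_smul, two_smul]

lemma reflMap_eq_reflIso (a : V) : reflMap a = reflIso a :=
  funext fun x => (reflIso_apply a x).symm

lemma reflIso_reflIso (a x : V) : reflIso a (reflIso a x) = x :=
  Submodule.reflection_reflection _ x

lemma reflIso_smul {c : ℝ} (hc : c ≠ 0) (a : V) : reflIso (c • a) = reflIso a := by
  ext x
  rw [reflIso_apply, reflIso_apply, smul_smul, inner_smul_right, inner_smul_right,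
    inner_smul_left]
  congr 2
  simp only [conj_trivial]
  rcases eq_or_ne a 0 with rfl | h
  · simp
  · have := inner_self_ne_zero (𝕜 := ℝ).2 h
    field_simp

lemma reflIso_map (w : V ≃ₗᵢ[ℝ] V) (a : V) : reflIso (w a) * w = w * reflIso a := by
  ext x
  simp only [LinearIsometryEquiv.coe_mul, Function.comp_apply, reflIso_apply, map_sub, map_smul,
    LinearIsometryEquiv.inner_map_map]

lemma inner_reflIso_left (a x z : V) : ⟪reflIso a x, z⟫ = ⟪x, reflIso a z⟫ := by
  conv_lhs => rw [← reflIso_reflIso a z]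
  exact LinearIsometryEquiv.inner_map_map _ _ _

/-- The product of the reflections in the vectors `α i`, for `i` running through a list. -/
def reflWord {n : ℕ} (α : Fin n → V) (l : List (Fin n)) : V ≃ₗᵢ[ℝ] V :=
  (l.map fun i => reflIso (α i)).prod

section Word

variable {n : ℕ} (α : Fin n → V)

lemma reflWord_nil : reflWord α [] = 1 := rfl

lemma reflWord_cons (i : Fin n) (l : List (Fin n)) :
    reflWord α (i :: l) = reflIso (α i) * reflWord α l := by
  simp [reflWord]

lemma reflWord_concat (l : List (Fin n)) (i : Fin n) :
    reflWord α (l ++ [i]) = reflWord α l * reflIso (α i) := by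
  simp [reflWord]

variable {α}

lemma exists_reflWord_of_mem_WK {K : Set (Fin n)} {s : Function.End V} (hs : s ∈ WK α K) :
    ∃ l : List (Fin n), (∀ k ∈ l, k ∈ K) ∧ ⇑(reflWord α l) = s := by
  induction hs using Submonoid.closure_induction_left with
  | one => exact ⟨[], by simp, rfl⟩
  | mul_left x hx y _ ih =>
    obtain ⟨k, hk, rfl⟩ := hx
    obtain ⟨l, hl, rfl⟩ := ih
    refine ⟨k :: l, by simpa using ⟨hk, hl⟩, ?_⟩
    rw [reflWord_cons, reflMap_eq_reflIso]
    rfl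

lemma exists_mem_WK_eq_reflWord {K : Set (Fin n)} {l : List (Fin n)} (hl : ∀ k ∈ l, k ∈ K) :
    ∃ s ∈ WK α K, s = ⇑(reflWord α l) := by
  induction l with
  | nil => exact ⟨1, Submonoid.one_mem _, rfl⟩
  | cons i t ih =>
    obtain ⟨s, hs, hst⟩ := ih fun k hk => hl k (by simp [hk])
    have hi : (reflMap (α i) : Function.End V) ∈ WK α K :=
      Submonoid.subset_closure ⟨i, hl i (by simp), rfl⟩
    refine ⟨_, Submonoid.mul_mem _ hi hs, ?_⟩
    rw [hst, reflMap_eq_reflIso, reflWord_cons]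
    rfl

end Word

namespace RootSystemData

variable {n : ℕ} (S : RootSystemData V n)

lemma reflIso_mem {i : Fin n} {x : V} (hx : x ∈ S.R) : reflIso (S.α i) x ∈ S.R := by
  rw [← S.hR_refl _ (S.hα_mem i), reflMap_eq_reflIso]
  exact Set.mem_image_of_mem _ hx

lemma reflWord_mem (l : List (Fin n)) {x : V} (hx : x ∈ S.R) : reflWord S.α l x ∈ S.R := by
  induction l with
  | nil => exact hx
  | cons i t ih =>
    rw [reflWord_cons]
    exact S.reflIso_mem ih

/-- The basis of simple roots. -/
def simpleBasis : Module.Basis (Fin n) ℝ V := .mk S.hα_indep S.hα_span.ge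

lemma simpleBasis_apply (i : Fin n) : S.simpleBasis i = S.α i := by
  simp [simpleBasis]

lemma sum_repr (x : V) : ∑ i, S.simpleBasis.repr x i • S.α i = x := by
  simpa only [simpleBasis_apply] using S.simpleBasis.sum_repr x

lemma repr_sign {β : V} (hβ : β ∈ S.R) :
    (∀ i, 0 ≤ S.simpleBasis.repr β i) ∨ (∀ i, S.simpleBasis.repr β i ≤ 0) := by
  obtain ⟨c, hc, hs⟩ := S.hα_sign β hβ
  have : ∀ i, S.simpleBasis.repr β i = c i := by
    intro i
    have := congrFun (S.simpleBasis.repr_sum_self c) i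
    simp only [simpleBasis_apply] at this
    rwa [← hc] at this
  simpa only [this] using hs

lemma repr_simple_of_ne {i j : Fin n} (h : j ≠ i) : S.simpleBasis.repr (S.α i) j = 0 := by
  rw [← simpleBasis_apply, S.simpleBasis.repr_self, Finsupp.single_eq_of_ne h]

lemma repr_reflIso_of_ne {i j : Fin n} (h : j ≠ i) (x : V) :
    S.simpleBasis.repr (reflIso (S.α i) x) j = S.simpleBasis.repr x j := by
  simp [reflIso_apply, S.repr_simple_of_ne h]

lemma repr_reflWord_of_notMem {K : Set (Fin n)} {l : List (Fin n)} (hl : ∀ k ∈ l, k ∈ K)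
    {j : Fin n} (hj : j ∉ K) (x : V) :
    S.simpleBasis.repr (reflWord S.α l x) j = S.simpleBasis.repr x j := by
  induction l with
  | nil => rfl
  | cons i t ih =>
    have hji : j ≠ i := fun h => hj (h ▸ hl i (by simp))
    rw [reflWord_cons, LinearIsometryEquiv.coe_mul, Function.comp_apply,
      S.repr_reflIso_of_ne hji, ih fun k hk => hl k (by simp [hk])]

lemma inner_eq_sum_repr (v x : V) :
    ⟪v, x⟫ = ∑ i, S.simpleBasis.repr x i * ⟪v, S.α i⟫ := by
  conv_lhs => rw [← S.sum_repr x, inner_sum]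
  simp only [inner_smul_right]

section Dominant

variable {S} {K : Set (Fin n)} {v : V} (hv : ∀ k ∈ K, 0 < ⟪v, S.α k⟫)

include hv

lemma repr_nonneg_of_inner_pos {β : V} (hβ : β ∈ S.R)
    (hK : ∀ j ∉ K, S.simpleBasis.repr β j = 0) (hpos : 0 < ⟪v, β⟫) (i : Fin n) :
    0 ≤ S.simpleBasis.repr β i := by
  rcases S.repr_sign hβ with h | h
  · exact h i
  · refine absurd hpos (not_lt.2 ?_)
    rw [S.inner_eq_sum_repr]
    refine Finset.sum_nonpos fun j _ => ?_
    by_cases hj : j ∈ K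
    · exact mul_nonpos_of_nonpos_of_nonneg (h j) (hv j hj).le
    · simp [hK j hj]

lemma repr_nonpos_of_inner_nonpos {β : V} (hβ : β ∈ S.R)
    (hK : ∀ j ∉ K, S.simpleBasis.repr β j = 0) (hnp : ⟪v, β⟫ ≤ 0) (i : Fin n) :
    S.simpleBasis.repr β i ≤ 0 := by
  rcases S.repr_sign hβ with h | h
  · rw [S.inner_eq_sum_repr] at hnp
    have hnn : ∀ j ∈ Finset.univ, 0 ≤ S.simpleBasis.repr β j * ⟪v, S.α j⟫ := by
      intro j _
      by_cases hj : j ∈ K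
      · exact mul_nonneg (h j) (hv j hj).le
      · simp [hK j hj]
    have h0 := (Finset.sum_eq_zero_iff_of_nonneg hnn).1
      (le_antisymm hnp (Finset.sum_nonneg hnn)) i (Finset.mem_univ i)
    by_cases hi : i ∈ K
    · exact ((mul_eq_zero.1 h0).resolve_right (hv i hi).ne').le
    · exact (hK i hi).le
  · exact h i

/-- A positive root made non-positive by a simple reflection gives the same reflection. -/
lemma reflIso_eq_of_inner_pos {β : V} (hβ : β ∈ S.R)
    (hK : ∀ j ∉ K, S.simpleBasis.repr β j = 0) (hpos : 0 < ⟪v, β⟫) {i : Fin n} (hi : i ∈ K)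
    (hnp : ⟪v, reflIso (S.α i) β⟫ ≤ 0) : reflIso β = reflIso (S.α i) := by
  have h0 : ∀ j, j ≠ i → S.simpleBasis.repr β j = 0 := by
    intro j hj
    refine le_antisymm ?_ (repr_nonneg_of_inner_pos hv hβ hK hpos j)
    rw [← S.repr_reflIso_of_ne hj]
    refine repr_nonpos_of_inner_nonpos hv (S.reflIso_mem hβ) (fun m hm => ?_) hnp j
    rw [S.repr_reflIso_of_ne fun h : m = i => hm (h ▸ hi), hK m hm]
  have hβi : β = S.simpleBasis.repr β i • S.α i := by
    conv_lhs => rw [← S.sum_repr β]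
    exact Finset.sum_eq_single i (fun j _ hj => by rw [h0 j hj, zero_smul]) (by simp)
  have hc : S.simpleBasis.repr β i ≠ 0 := by
    intro h
    rw [h, zero_smul] at hβi
    exact S.hR_ne0 β hβ hβi
  rw [hβi, reflIso_smul hc]

/-- The exchange condition. -/
lemma exists_shorter_reflWord {l : List (Fin n)} (hl : ∀ k ∈ l, k ∈ K) {k : Fin n} (hk : k ∈ K)
    (hnp : ⟪v, reflWord S.α l (S.α k)⟫ ≤ 0) :
    ∃ l' : List (Fin n), (∀ k ∈ l', k ∈ K) ∧ l'.length < l.length ∧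
      reflWord S.α l * reflIso (S.α k) = reflWord S.α l' := by
  induction l with
  | nil => exact absurd (hv k hk) (not_lt.2 hnp)
  | cons i t ih =>
    have ht : ∀ k ∈ t, k ∈ K := fun k hk => hl k (by simp [hk])
    have hi : i ∈ K := hl i (by simp)
    by_cases h : ⟪v, reflWord S.α t (S.α k)⟫ ≤ 0
    · obtain ⟨t', ht', hlen, heq⟩ := ih ht h
      refine ⟨i :: t', by simpa using ⟨hi, ht'⟩, by simpa using hlen, ?_⟩
      rw [reflWord_cons, reflWord_cons, mul_assoc, heq]
    · refine ⟨t, ht, by simp, ?_⟩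
      have hr : reflIso (reflWord S.α t (S.α k)) = reflIso (S.α i) := by
        refine reflIso_eq_of_inner_pos hv (S.reflWord_mem t (S.hα_mem k)) (fun j hj => ?_)
          (not_le.1 h) hi ?_
        · rw [S.repr_reflWord_of_notMem ht hj, S.repr_simple_of_ne fun h : j = k => hj (h ▸ hk)]
        · rwa [reflWord_cons] at hnp
      rw [reflWord_cons, ← hr, reflIso_map, mul_assoc]
      ext x
      simp [reflIso_reflIso]

/-- If `v` is strictly `K`-dominant and `y` is `K`-dominant, then `y` is the unique maximizer of
`⟪v, ·⟫` on its `W_K`-orbit. -/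
lemma inner_reflWord_le {y : V} (hy : ∀ k ∈ K, 0 ≤ ⟪y, S.α k⟫) (l : List (Fin n))
    (hl : ∀ k ∈ l, k ∈ K) : ⟪v, reflWord S.α l y⟫ ≤ ⟪v, y⟫ ∧
      (⟪v, reflWord S.α l y⟫ = ⟪v, y⟫ → reflWord S.α l y = y) := by
  induction hm : l.length using Nat.strong_induction_on generalizing l with
  | _ m ih =>
    rcases List.eq_nil_or_concat l with rfl | ⟨t, k, rfl⟩
    · simp [reflWord_nil]
    have ht : ∀ j ∈ t, j ∈ K := fun j hj => hl j (by simp [hj])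
    have hk : k ∈ K := hl k (by simp)
    have hlen : t.length < m := by simp at hm; omega
    rw [List.concat_eq_append, reflWord_concat]
    by_cases h : ⟪v, reflWord S.α t (S.α k)⟫ ≤ 0
    · obtain ⟨t', ht', hlt, heq⟩ := exists_shorter_reflWord hv ht hk h
      rw [heq]
      exact ih t'.length (hlt.trans hlen) t' ht' rfl
    · obtain ⟨hle, himp⟩ := ih t.length hlen t ht rfl
      have ha : 0 < ⟪S.α k, S.α k⟫ := real_inner_self_pos.2 (S.hR_ne0 _ (S.hα_mem k))
      set c := 2 * ⟪y, S.α k⟫ / ⟪S.α k, S.α k⟫ with hc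
      have hc0 : 0 ≤ c := div_nonneg (mul_nonneg zero_le_two (hy k hk)) ha.le
      have hexp : (reflWord S.α t * reflIso (S.α k)) y
          = reflWord S.α t y - c • reflWord S.α t (S.α k) := by
        rw [LinearIsometryEquiv.coe_mul, Function.comp_apply, reflIso_apply, map_sub, map_smul]
      rw [hexp, inner_sub_right, inner_smul_right]
      have hp := mul_nonneg hc0 (not_le.1 h).le
      refine ⟨by linarith, fun he => ?_⟩
      have hz : c * ⟪v, reflWord S.α t (S.α k)⟫ = 0 := by linarith
      rw [(mul_eq_zero.1 hz).resolve_right (not_le.1 h).ne', zero_smul, sub_zero]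
      exact himp (by linarith)

end Dominant

lemma finite_range_reflWord : (Set.range (reflWord S.α)).Finite := by
  have hfin : (Set.univ.pi fun _ : Fin n => S.R).Finite := Set.Finite.pi fun _ => S.hR_fin
  refine Set.Finite.of_injOn (f := fun w : V ≃ₗᵢ[ℝ] V => fun i => w (S.α i)) ?_ ?_ hfin
  · rintro _ ⟨l, rfl⟩ i _
    exact S.reflWord_mem l (S.hα_mem i)
  · intro w _ w' _ h
    have : w.toLinearEquiv.toLinearMap = w'.toLinearEquiv.toLinearMap :=
      S.simpleBasis.ext fun i => by simpa [simpleBasis_apply] using congrFun h i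
    ext x
    exact LinearMap.congr_fun this x

end RootSystemData

namespace PermSetup

variable {n : ℕ} (S : PermSetup V n)

/-- The union of the `W`-orbits of the points of `Λ`. -/
def orbit : Set V := {x | ∃ l : List (Fin n), ∃ p ∈ S.Λ, reflWord S.α l p = x}

lemma P_eq_convexHull_orbit : S.P = convexHull ℝ S.orbit := by
  rw [PermSetup.P]
  congr 1
  ext x
  simp only [Set.mem_iUnion, exists_prop, orbit, Set.mem_ofPred_eq]
  constructor
  · rintro ⟨w, hw, p, hp, rfl⟩
    obtain ⟨l, -, rfl⟩ := exists_reflWord_of_mem_WK hw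
    exact ⟨l, p, hp, rfl⟩
  · rintro ⟨l, p, hp, rfl⟩
    obtain ⟨s, hs, hsl⟩ := exists_mem_WK_eq_reflWord (α := S.α) (l := l) fun _ _ => Set.mem_univ _
    exact ⟨s, hs, p, hp, by rw [hsl]⟩

lemma finite_orbit : S.orbit.Finite := by
  refine ((S.finite_range_reflWord.prod S.hΛ_fin).image fun q => q.1 q.2).subset ?_
  rintro _ ⟨l, p, hp, rfl⟩
  exact ⟨(reflWord S.α l, p), ⟨⟨l, rfl⟩, hp⟩, rfl⟩

lemma reflIso_mem_orbit (i : Fin n) {x : V} (hx : x ∈ S.orbit) : reflIso (S.α i) x ∈ S.orbit := by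
  obtain ⟨l, p, hp, rfl⟩ := hx
  exact ⟨i :: l, p, hp, by rw [reflWord_cons]; rfl⟩

lemma reflIso_mem_P (i : Fin n) {x : V} (hx : x ∈ S.P) : reflIso (S.α i) x ∈ S.P := by
  rw [P_eq_convexHull_orbit] at hx ⊢
  have h := Set.mem_image_of_mem (reflIso (S.α i)).toLinearEquiv.toLinearMap hx
  rw [LinearMap.image_convexHull] at h
  refine convexHull_mono ?_ h
  rintro _ ⟨z, hz, rfl⟩
  exact S.reflIso_mem_orbit i hz

lemma reflWord_mem_P_iff (l : List (Fin n)) {x : V} : reflWord S.α l x ∈ S.P ↔ x ∈ S.P := by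
  induction l with
  | nil => rfl
  | cons i t ih =>
    rw [← ih, reflWord_cons]
    refine ⟨fun h => ?_, fun h => S.reflIso_mem_P i h⟩
    simpa [reflIso_reflIso] using S.reflIso_mem_P i h

lemma isCompact_P : IsCompact S.P := by
  rw [P_eq_convexHull_orbit]
  exact S.finite_orbit.isCompact_convexHull ℝ

lemma extremePoints_P_subset : S.P.extremePoints ℝ ⊆ S.orbit := by
  rw [P_eq_convexHull_orbit]
  exact extremePoints_convexHull_subset

lemma orbit_subset_P : S.orbit ⊆ S.P := by
  rw [P_eq_convexHull_orbit]
  exact subset_convexHull ℝ _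

variable {S} in
lemma Nondegenerate.inner_ne_zero (hnd : S.Nondegenerate) {x : V} (hx : x ∈ S.orbit) {β : V}
    (hβ : β ∈ S.R) : ⟪x, β⟫ ≠ 0 := by
  obtain ⟨l, p, hp, rfl⟩ := hx
  induction l generalizing β with
  | nil =>
    intro h0
    have hpos : ∀ k ∈ (Set.univ : Set (Fin n)), 0 < ⟪p, S.α k⟫ := fun k _ => hnd p hp k
    have hrepr := RootSystemData.repr_nonpos_of_inner_nonpos hpos hβ (by simp) h0.le
    have h1 : ⟪p, β⟫ = 0 := h0
    rw [S.inner_eq_sum_repr, Finset.sum_eq_zero_iff_of_nonpos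
      fun i _ => mul_nonpos_of_nonpos_of_nonneg (hrepr i) (hnd p hp i).le] at h1
    refine S.hR_ne0 β hβ ?_
    rw [← S.sum_repr β]
    refine Finset.sum_eq_zero fun i hi => ?_
    rw [(mul_eq_zero.1 (h1 i hi)).resolve_right (hnd p hp i).ne', zero_smul]
  | cons i t ih =>
    rw [reflWord_cons, LinearIsometryEquiv.coe_mul, Function.comp_apply, inner_reflIso_left]
    exact ih (S.reflIso_mem hβ)

/-- The points of `P` at which `⟪y, ·⟫` is maximal. -/
def face (y : V) : Set V := {x | x ∈ S.P ∧ ∀ z ∈ S.P, ⟪y, z⟫ ≤ ⟪y, x⟫}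

lemma isExposed_face (y : V) : IsExposed ℝ S.P (S.face y) := fun _ => ⟨innerSL ℝ y, rfl⟩

lemma reflWord_image_face (l : List (Fin n)) (y : V) :
    reflWord S.α l '' S.face y = S.face (reflWord S.α l y) := by
  ext x
  obtain ⟨x, rfl⟩ := (reflWord S.α l).surjective x
  rw [(reflWord S.α l).injective.mem_set_image]
  simp only [face, Set.mem_ofPred_eq, LinearIsometryEquiv.inner_map_map, S.reflWord_mem_P_iff]
  refine and_congr_right fun _ => ⟨fun h z hz => ?_, fun h z hz => ?_⟩
  · obtain ⟨z, rfl⟩ := (reflWord S.α l).surjective z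
    rw [LinearIsometryEquiv.inner_map_map]
    exact h z ((S.reflWord_mem_P_iff l).1 hz)
  · simpa only [LinearIsometryEquiv.inner_map_map] using h _ ((S.reflWord_mem_P_iff l).2 hz)

lemma exists_orbit_mem_of_isExposed {G : Set V} (hG : IsExposed ℝ S.P G) (hne : G.Nonempty) :
    ∃ v ∈ S.orbit, v ∈ G := by
  obtain ⟨v, hv⟩ := (hG.isCompact S.isCompact_P).extremePoints_nonempty hne
  exact ⟨v, S.extremePoints_P_subset (hG.isExtreme.extremePoints_subset_extremePoints hv), hv.1⟩

lemma inner_mul_inner_nonneg {y v : V} (hv : v ∈ S.face y) (k : Fin n) :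
    0 ≤ ⟪y, S.α k⟫ * ⟪v, S.α k⟫ := by
  have h := hv.2 _ (S.reflIso_mem_P k hv.1)
  have ha : 0 < ⟪S.α k, S.α k⟫ := real_inner_self_pos.2 (S.hR_ne0 _ (S.hα_mem k))
  rw [reflIso_apply, inner_sub_right, inner_smul_right, sub_le_self_iff, div_mul_eq_mul_div,
    le_div_iff₀ ha] at h
  linarith

variable {S} in
lemma Nondegenerate.dominant_of_barycenter_mem (hnd : S.Nondegenerate) {K : Set (Fin n)} {y : V}
    (hne : (S.face y).Nonempty) (hb : barycenter (S.face y) ∈ cham S.α K) :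
    ∀ k ∈ K, 0 ≤ ⟪y, S.α k⟫ := by
  intro k hk
  by_contra! hneg
  have hexp := S.isExposed_face y
  have hsub : (S.face y).extremePoints ℝ ⊆ S.orbit :=
    hexp.isExtreme.extremePoints_subset_extremePoints.trans S.extremePoints_P_subset
  have hfin := S.finite_orbit.subset hsub
  have hne' := (hexp.isCompact S.isCompact_P).extremePoints_nonempty hne
  have hlt : (S.face y).extremePoints ℝ ⊆ {x | ⟪S.α k, x⟫ < 0} := by
    intro v hv
    have h1 := S.inner_mul_inner_nonneg hv.1 k
    have h2 := hnd.inner_ne_zero (hsub hv) (S.hα_mem k)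
    rw [Set.mem_ofPred_eq, real_inner_comm]
    exact lt_of_le_of_ne (nonpos_of_mul_nonneg_right h1 hneg) h2
  have hmem := hfin.toFinset.centroid_mem_convexHull (R := ℝ) (hfin.toFinset_nonempty.2 hne')
  rw [hfin.coe_toFinset] at hmem
  have hconv : Convex ℝ {x | ⟪S.α k, x⟫ < 0} :=
    convex_halfSpace_lt (innerSL ℝ (S.α k)).isLinear 0
  have h3 : ⟪S.α k, barycenter (S.face y)⟫ < 0 := by
    rw [barycenter, dif_pos hfin]
    exact convexHull_min hlt hconv hmem
  have h4 := hb k hk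
  rw [real_inner_comm] at h4
  linarith

end PermSetup

/-- Lemma 2.5(2): if `P` is nondegenerate and `F` is a facet of `P` with barycenter in
`C_K`, then for every `s ∈ W_K`, either `s(F) = F` or `s(F) ∩ F = ∅`. -/
theorem statement_9 {V : Type*} [NormedAddCommGroup V] [InnerProductSpace ℝ V]
    [FiniteDimensional ℝ V] {n : ℕ} (S : PermSetup V n)
    (hfull : (interior S.P).Nonempty) (hnd : S.Nondegenerate) (K : Set (Fin n))
    (F : Set V) (hF : IsFacet S.P F) (hb : barycenter F ∈ cham S.α K) :
    ∀ s ∈ WK S.α K, Set.image s F = F ∨ Set.image s F ∩ F = ∅ := by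
  intro s hs
  obtain ⟨l₀, hl₀, rfl⟩ := exists_reflWord_of_mem_WK hs
  by_contra! hcon
  obtain ⟨hne₀, hinter⟩ := hcon
  obtain ⟨x, hxs, hxF⟩ := hinter
  obtain ⟨f, hf⟩ := hF.1 ⟨x, hxF⟩
  obtain ⟨y, rfl⟩ : ∃ y : V, F = S.face y := by
    refine ⟨(InnerProductSpace.toDual ℝ V).symm f, ?_⟩
    rw [hf]
    simp only [PermSetup.face, InnerProductSpace.toDual_symm_apply]
  have hy := hnd.dominant_of_barycenter_mem ⟨x, hxF⟩ hb
  obtain ⟨p, hp⟩ := S.hΛ_ne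
  let B : Set V := {v | v ∈ S.orbit ∧ v ∈ S.face y ∧ ∃ l : List (Fin n), (∀ k ∈ l, k ∈ K) ∧
    reflWord S.α l '' S.face y ≠ S.face y ∧ v ∈ reflWord S.α l '' S.face y}
  have hBfin : B.Finite := S.finite_orbit.subset fun v hv => hv.1
  have hBne : B.Nonempty := by
    have hexp : IsExposed ℝ S.P (reflWord S.α l₀ '' S.face y ∩ S.face y) := by
      rw [S.reflWord_image_face]
      exact (S.isExposed_face _).inter (S.isExposed_face y)
    obtain ⟨v, hvo, hv⟩ := S.exists_orbit_mem_of_isExposed hexp ⟨x, hxs, hxF⟩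
    exact ⟨v, hvo, hv.2, l₀, hl₀, hne₀, hv.1⟩
  obtain ⟨v, ⟨hvo, hvF, l, hl, hne, hvl⟩, hmax⟩ := Set.exists_max_image B (fun v => ⟪p, v⟫)
    hBfin hBne
  have hv : ∀ k ∈ K, 0 < ⟪v, S.α k⟫ := by
    intro k hk
    have h0 := hnd.inner_ne_zero hvo (S.hα_mem k)
    refine lt_of_le_of_ne ?_ h0.symm
    rcases (hy k hk).lt_or_eq with hyk | hyk
    · exact nonneg_of_mul_nonneg_right (S.inner_mul_inner_nonneg hvF k) hyk
    · by_contra! hneg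
      have ha : 0 < ⟪S.α k, S.α k⟫ := real_inner_self_pos.2 (S.hR_ne0 _ (S.hα_mem k))
      have hfix : reflIso (S.α k) '' S.face y = S.face y := by
        have h := S.reflWord_image_face [k] y
        have hyy : reflIso (S.α k) y = y := by simp [reflIso_apply, ← hyk]
        simpa [reflWord, hyy] using h
      have hcomp : reflWord S.α (k :: l) '' S.face y
          = reflIso (S.α k) '' (reflWord S.α l '' S.face y) := by
        rw [reflWord_cons, LinearIsometryEquiv.coe_mul, Set.image_comp]
      have hmem : reflIso (S.α k) v ∈ B := by
        refine ⟨S.reflIso_mem_orbit k hvo, hfix ▸ Set.mem_image_of_mem _ hvF, k :: l,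
          by simpa using ⟨hk, hl⟩, ?_, hcomp ▸ Set.mem_image_of_mem _ hvl⟩
        rw [hcomp]
        intro h
        exact hne ((reflIso (S.α k)).injective.image_injective (h.trans hfix.symm))
      have hle := hmax _ hmem
      simp only [reflIso_apply, inner_sub_right, inner_smul_right] at hle
      have hlt : 2 * ⟪v, S.α k⟫ / ⟪S.α k, S.α k⟫ < 0 := div_neg_of_neg_of_pos (by linarith) ha
      have := mul_neg_of_neg_of_pos hlt (hnd p hp k)
      linarith
  have heq : ⟪v, reflWord S.α l y⟫ = ⟪v, y⟫ := by
    obtain ⟨u, hu, rfl⟩ := hvl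
    rw [LinearIsometryEquiv.inner_map_map, real_inner_comm, real_inner_comm y]
    exact le_antisymm (hvF.2 u hu.1) (hu.2 _ hvF.1)
  have hfixed := (RootSystemData.inner_reflWord_le hv hy l hl).2 heq
  exact hne (by rw [S.reflWord_image_face, hfixed])
end
end

section
/- Lemma (geometric core of Lemma 2.8). Let P ⊆ V be a full-dimensional polytope, and let β_1, …, β_q ∈ V be nonzero vectors such that for each j, r_{β_j}(P) = P and no extreme point x of P satisfies ⟨x, β_j⟩ = 0. Let F_1, …, F_p be facets of P such that F_1 ∩ ⋯ ∩ F_p ≠ ∅ and F_i ∩ H_{β_j} ≠ ∅ for all 1 ≤ i ≤ p and 1 ≤ j ≤ q. Then F_1 ∩ ⋯ ∩ F_p ∩ H_{β_1} ∩ ⋯ ∩ H_{β_q} ≠ ∅. -/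
open scoped RealInnerProductSpace

noncomputable section

variable {V : Type*} [NormedAddCommGroup V] [InnerProductSpace ℝ V]

lemma apply_reflMap {V : Type*} [NormedAddCommGroup V] [InnerProductSpace ℝ V]
    (l : V →L[ℝ] ℝ) (β x : V) :
    l (reflMap β x) = l x - 2 * ⟪x, β⟫ / ⟪β, β⟫ * l β := by
  simp [reflMap]

/-- If a compact extreme subset of `P` meets `H_β`, and no extreme point of `P` lies on `H_β`,
then it contains a point strictly on the negative side of `H_β`. -/
lemma exists_inner_neg_of_isExtreme {V : Type*} [NormedAddCommGroup V] [InnerProductSpace ℝ V]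
    {P F : Set V} {β : V} (hF : IsExtreme ℝ P F) (hc : IsCompact F)
    (hnd : ∀ x ∈ Set.extremePoints ℝ P, ⟪x, β⟫ ≠ 0) (hm : (F ∩ hplane β).Nonempty) :
    ∃ y ∈ F, ⟪y, β⟫ < 0 := by
  by_contra! h
  have hcont : Continuous fun x : V => ⟪x, β⟫ := by fun_prop
  have hcl : IsClosed (hplane β) := isClosed_eq hcont continuous_const
  have hext : IsExtreme ℝ F (F ∩ hplane β) := by
    refine ⟨Set.inter_subset_left, fun x hx y hy z hz hzs => ⟨hx, ?_⟩⟩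
    obtain ⟨a, b, ha, hb, -, rfl⟩ := hzs
    have h0 : a * ⟪x, β⟫ + b * ⟪y, β⟫ = 0 := by
      have := hz.2
      simpa [hplane, inner_add_left, inner_smul_left] using this
    have hx0 := mul_nonneg ha.le (h x hx)
    have hy0 := mul_nonneg hb.le (h y hy)
    have : a * ⟪x, β⟫ = 0 := by linarith
    exact (mul_eq_zero.mp this).resolve_left ha.ne'
  obtain ⟨x, hx⟩ := (hc.inter_right hcl).extremePoints_nonempty hm
  exact hnd x ((hF.trans hext).extremePoints_subset_extremePoints hx) hx.1.2

/-- An exposed face of a reflection-invariant compact set that meets the mirror is invariant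
under the reflection, provided that no extreme point lies on the mirror. -/
lemma reflMap_mem_of_isExposed {V : Type*} [NormedAddCommGroup V] [InnerProductSpace ℝ V]
    {P F : Set V} {β : V} (hF : IsExposed ℝ P F) (hP : IsCompact P) (hβ : β ≠ 0)
    (hsym : ∀ x ∈ P, reflMap β x ∈ P)
    (hnd : ∀ x ∈ Set.extremePoints ℝ P, ⟪x, β⟫ ≠ 0) (hm : (F ∩ hplane β).Nonempty)
    {x : V} (hx : x ∈ F) : reflMap β x ∈ F := by
  have hc : IsCompact F := hF.isCompact hP
  obtain ⟨y, hy, hyn⟩ := exists_inner_neg_of_isExtreme hF.isExtreme hc hnd hm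
  obtain ⟨z, hz, hzp⟩ := exists_inner_neg_of_isExtreme (β := -β) hF.isExtreme hc
    (by simpa using hnd) (by simpa [hplane] using hm)
  rw [inner_neg_right, neg_lt_zero] at hzp
  obtain ⟨l, rfl⟩ := hF ⟨x, hx⟩
  have hββ : 0 < ⟪β, β⟫ := real_inner_self_pos.mpr hβ
  have hy1 := hy.2 _ (hsym y hy.1)
  have hz1 := hz.2 _ (hsym z hz.1)
  rw [apply_reflMap] at hy1 hz1
  have hyc : 2 * ⟪y, β⟫ / ⟪β, β⟫ < 0 := div_neg_of_neg_of_pos (by linarith) hββ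
  have hzc : 0 < 2 * ⟪z, β⟫ / ⟪β, β⟫ := by positivity
  have hl : l β = 0 := by
    apply le_antisymm
    · by_contra! h
      nlinarith [mul_neg_of_neg_of_pos hyc h]
    · by_contra! h
      nlinarith [mul_neg_of_pos_of_neg hzc h]
  refine ⟨hsym x hx.1, fun w hw => ?_⟩
  rw [apply_reflMap, hl, mul_zero, sub_zero]
  exact hx.2 w hw

/-- A point of minimal norm in a convex set invariant under `r_β` lies on `H_β`. -/
lemma mem_hplane_of_norm_min {V : Type*} [NormedAddCommGroup V] [InnerProductSpace ℝ V]
    {G : Set V} {β c : V} (hG : Convex ℝ G) (hβ : β ≠ 0) (hc : c ∈ G) (hr : reflMap β c ∈ G)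
    (hmin : ∀ x ∈ G, ‖c‖ ≤ ‖x‖) : c ∈ hplane β := by
  have hββ : 0 < ⟪β, β⟫ := real_inner_self_pos.mpr hβ
  have hmid := hG hc hr (a := 1 / 2) (b := 1 / 2) (by norm_num) (by norm_num) (by norm_num)
  have heq : (1 / 2 : ℝ) • c + (1 / 2 : ℝ) • reflMap β c = c - (⟪c, β⟫ / ⟪β, β⟫) • β := by
    unfold reflMap
    module
  rw [heq] at hmid
  have h1 := pow_le_pow_left₀ (norm_nonneg c) (hmin _ hmid) 2
  rw [norm_sub_sq_real, inner_smul_right, norm_smul, mul_pow, ← real_inner_self_eq_norm_sq β,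
    Real.norm_eq_abs, sq_abs] at h1
  have h2 : (⟪c, β⟫ / ⟪β, β⟫) ^ 2 * ⟪β, β⟫ = ⟪c, β⟫ / ⟪β, β⟫ * ⟪c, β⟫ := by field_simp
  have h3 : ⟪c, β⟫ / ⟪β, β⟫ * ⟪c, β⟫ = ⟪c, β⟫ ^ 2 / ⟪β, β⟫ := by ring
  have h4 : ⟪c, β⟫ ^ 2 / ⟪β, β⟫ ≤ 0 := by linarith
  have h5 : ⟪c, β⟫ ^ 2 ≤ 0 := by
    by_contra! h
    exact absurd (div_pos h hββ) h4.not_gt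
  exact pow_eq_zero_iff two_ne_zero |>.mp (le_antisymm h5 (sq_nonneg _))

/-- Geometric core of Lemma 2.8: if the reflections `r_{β_j}` preserve the
full-dimensional polytope `P`, no extreme point of `P` lies on any `H_{β_j}`, the
facets `F_1, …, F_p` have a common point, and each `F_i` meets each `H_{β_j}`, then
`F_1 ∩ ⋯ ∩ F_p ∩ H_{β_1} ∩ ⋯ ∩ H_{β_q} ≠ ∅`. -/
theorem statement_12 {V : Type*} [NormedAddCommGroup V] [InnerProductSpace ℝ V]
    [FiniteDimensional ℝ V] (hn : 1 ≤ Module.finrank ℝ V)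
    (P : Set V) (hP : ∃ A : Set V, A.Finite ∧ P = convexHull ℝ A)
    (hfull : (interior P).Nonempty)
    (q : ℕ) (β : Fin q → V) (hβ0 : ∀ j, β j ≠ 0)
    (hsym : ∀ j, reflMap (β j) '' P = P)
    (hnd : ∀ j, ∀ x ∈ Set.extremePoints ℝ P, ⟪x, β j⟫ ≠ 0)
    (p : ℕ) (Fs : Fin p → Set V) (hFs : ∀ i, IsFacet P (Fs i))
    (hne : (⋂ i, Fs i).Nonempty)
    (hmeet : ∀ i j, (Fs i ∩ hplane (β j)).Nonempty) :
    ((⋂ i, Fs i) ∩ ⋂ j, hplane (β j)).Nonempty := by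
  obtain ⟨A, hA, hPA⟩ := hP
  have hPc : IsCompact P := hPA ▸ hA.isCompact_convexHull ℝ
  have hPconv : Convex ℝ P := hPA ▸ convex_convexHull ℝ A
  have hsym' : ∀ j, ∀ x ∈ P, reflMap (β j) x ∈ P := fun j x hx =>
    hsym j ▸ Set.mem_image_of_mem _ hx
  have hGc : IsCompact (P ∩ ⋂ i, Fs i) :=
    hPc.inter_right (isClosed_iInter fun i => (hFs i).1.isClosed hPc.isClosed)
  have hGconv : Convex ℝ (P ∩ ⋂ i, Fs i) :=
    hPconv.inter (convex_iInter fun i => (hFs i).1.convex hPconv)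
  have hGne : (P ∩ ⋂ i, Fs i).Nonempty := by
    rcases isEmpty_or_nonempty (Fin p) with hp | ⟨⟨i⟩⟩
    · obtain ⟨x, hx⟩ := hfull
      exact ⟨x, interior_subset hx, by simp⟩
    · obtain ⟨x, hx⟩ := hne
      exact ⟨x, (hFs i).1.subset (Set.mem_iInter.mp hx i), hx⟩
  obtain ⟨c, hc, hmin⟩ := hGc.exists_isMinOn hGne continuous_norm.continuousOn
  refine ⟨c, hc.2, Set.mem_iInter.mpr fun j => ?_⟩
  refine mem_hplane_of_norm_min hGconv (hβ0 j) hc ⟨hsym' j c hc.1, ?_⟩ fun x hx => hmin hx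
  exact Set.mem_iInter.mpr fun i => reflMap_mem_of_isExposed (hFs i).1 hPc (hβ0 j) (hsym' j)
    (hnd j) (hmeet i j) (Set.mem_iInter.mp hc.2 i)
end
end

section
/- Lemma (Lemma 4.6(1), stated over ℝ). Let K ⊆ {1, …, n} and assume P is nondegenerate and simple. Each s ∈ W_K permutes the finite facet set 𝔉(P) via F ↦ s(F), and the induced variable-renaming automorphism of ℝ[X_F : F ∈ 𝔉(P)] maps the ideal I_P onto itself, so that W_K acts on the Stanley–Reisner ring 𝒮ℛ(P) by ℝ-algebra automorphisms. Then the invariant subalgebra 𝒮ℛ(P)^{W_K} is generated, as an ℝ-algebra, by the classes of the orbit sums ∑_{F' ∈ W_K·F} X_{F'}, where F ranges over the facets of P and W_K·F denotes the W_K-orbit of the facet F. -/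
open scoped RealInnerProductSpace

noncomputable section

variable {V : Type*} [NormedAddCommGroup V] [InnerProductSpace ℝ V]

/-- The type of facets of `Q`. -/
abbrev Facets (Q : Set V) := {F : Set V // IsFacet Q F}

/-- `u` is the unit outward normal of the facet `F` of `Q`. -/
def IsOutwardNormal (Q F : Set V) (u : V) : Prop :=
  ‖u‖ = 1 ∧ F = {x ∈ Q | ∀ y ∈ Q, ⟪u, y⟫ ≤ ⟪u, x⟫}

open Classical in
/-- The unit outward normal `ℓ_F` of a facet `F` of `Q`. -/
def normalVec (Q F : Set V) : V :=
  if h : ∃ u : V, IsOutwardNormal Q F u then h.choose else 0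

/-- The Stanley–Reisner ideal `I_Q`, generated by the square-free monomials
`X_{F_1} ⋯ X_{F_p}` with `F_1 ∩ ⋯ ∩ F_p = ∅`. -/
def srIdeal (Q : Set V) : Ideal (MvPolynomial (Facets Q) ℝ) :=
  Ideal.span {p | ∃ t : Finset (Facets Q), (⋂ F ∈ t, (F.1 : Set V)) = ∅ ∧
    p = ∏ F ∈ t, MvPolynomial.X F}

/-- The ideal `J_Q` generated by the linear forms `∑_F ⟪u, ℓ_F⟫ X_F` for `u ∈ V`. -/
def linIdeal (Q : Set V) : Ideal (MvPolynomial (Facets Q) ℝ) :=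
  Ideal.span {p | ∃ u : V,
    p = ∑ᶠ F : Facets Q, MvPolynomial.C ⟪u, normalVec Q F.1⟫ * MvPolynomial.X F}

/-- The ideal `I_Q + J_Q`. -/
def polyIdeal (Q : Set V) : Ideal (MvPolynomial (Facets Q) ℝ) := srIdeal Q + linIdeal Q

/-- The polytopal algebra `𝒜(Q) = ℝ[X_F : F ∈ 𝔉(Q)]/(I_Q + J_Q)`. -/
abbrev PolyAlg (Q : Set V) := MvPolynomial (Facets Q) ℝ ⧸ polyIdeal Q

/-- The quotient map onto the polytopal algebra. -/
def polyMk (Q : Set V) : MvPolynomial (Facets Q) ℝ →ₐ[ℝ] PolyAlg Q :=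
  Ideal.Quotient.mkₐ ℝ (polyIdeal Q)

/-- The invariant subalgebra of an action `ρ` of a monoid `G` by `ℝ`-algebra
automorphisms: the elements fixed by every `ρ g`. -/
def invariants {A : Type*} [CommRing A] [Algebra ℝ A] {G : Type*} [Monoid G]
    (ρ : G →* (A ≃ₐ[ℝ] A)) : Subalgebra ℝ A where
  carrier := {a : A | ∀ g : G, ρ g a = a}
  mul_mem' := fun {a b} ha hb g => by
    simp only [Set.mem_setOf_eq] at ha hb ⊢
    rw [map_mul, ha g, hb g]
  one_mem' := fun g => map_one (ρ g)
  add_mem' := fun {a b} ha hb g => by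
    simp only [Set.mem_setOf_eq] at ha hb ⊢
    rw [map_add, ha g, hb g]
  zero_mem' := fun g => map_zero (ρ g)
  algebraMap_mem' := fun r g => (ρ g).commutes r

/-- The Stanley–Reisner ring `𝒮ℛ(Q) = ℝ[X_F : F ∈ 𝔉(Q)]/I_Q`. -/
abbrev SRAlg (Q : Set V) := MvPolynomial (Facets Q) ℝ ⧸ srIdeal Q

/-- The quotient map onto the Stanley–Reisner ring. -/
def srMk (Q : Set V) : MvPolynomial (Facets Q) ℝ →ₐ[ℝ] SRAlg Q :=
  Ideal.Quotient.mkₐ ℝ (srIdeal Q)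

open Classical in
/-- The orbit sum `∑_{F' ∈ W_K·F} X_{F'}` over the `W_K`-orbit of the facet `F`. -/
noncomputable def orbitSum {n : ℕ} (S : PermSetup V n) (K : Set (Fin n))
    (F : Facets S.P) : MvPolynomial (Facets S.P) ℝ :=
  ∑ᶠ F' : Facets S.P,
    if ∃ s ∈ WK S.α K, F'.1 = Set.image s F.1 then MvPolynomial.X F' else 0

/-- The reflection `reflMap α` as a linear isometry. -/
def reflEquiv (α : V) : V ≃ₗᵢ[ℝ] V := (ℝ ∙ α)ᗮ.reflection

theorem coe_reflEquiv (α : V) : ⇑(reflEquiv α) = reflMap α := by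
  ext x
  rw [reflEquiv, Submodule.reflection_orthogonal_apply, Submodule.reflection_singleton_apply,
    reflMap, real_inner_self_eq_norm_sq, real_inner_comm x α]
  simp only [RCLike.ofReal_real_eq_id, id_eq, neg_sub]
  rw [← Nat.cast_smul_eq_nsmul ℝ, smul_smul]
  congr 2
  push_cast
  ring

theorem reflEquiv_apply (α x : V) :
    reflEquiv α x = x - (2 * ⟪x, α⟫ / ⟪α, α⟫) • α := by
  rw [coe_reflEquiv, reflMap]

theorem reflEquiv_mul_self (α : V) : reflEquiv α * reflEquiv α = 1 :=
  Submodule.reflection_mul_reflection _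

theorem reflEquiv_symm (α : V) : (reflEquiv α).symm = reflEquiv α :=
  Submodule.reflection_symm

theorem reflEquiv_map (L : V ≃ₗᵢ[ℝ] V) (α : V) : reflEquiv (L α) * L = L * reflEquiv α := by
  ext x
  simp [reflEquiv_apply, LinearIsometryEquiv.inner_map_map]

theorem reflEquiv_smul {c : ℝ} (hc : c ≠ 0) (α : V) : reflEquiv (c • α) = reflEquiv α := by
  ext x
  by_cases hα : α = 0
  · simp [hα]
  have h : ⟪α, α⟫ ≠ 0 := inner_self_ne_zero.2 hα
  simp only [reflEquiv_apply, inner_smul_left, inner_smul_right, smul_smul]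
  congr 2
  simp only [conj_trivial]
  field_simp

/-- Every element of `WK α K` is a linear isometry whose inverse also lies in `WK α K`. -/
theorem exists_isometryEquiv_of_mem_WK {n : ℕ} {α : Fin n → V} {K : Set (Fin n)}
    {s : Function.End V} (hs : s ∈ WK α K) :
    ∃ L : V ≃ₗᵢ[ℝ] V, ⇑L = s ∧ (⇑L.symm : Function.End V) ∈ WK α K := by
  induction hs using Submonoid.closure_induction with
  | mem x hx =>
    obtain ⟨k, hk, rfl⟩ := hx
    refine ⟨reflEquiv (α k), coe_reflEquiv _, ?_⟩
    rw [reflEquiv_symm, coe_reflEquiv]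
    exact Submonoid.subset_closure ⟨k, hk, rfl⟩
  | one => exact ⟨1, rfl, one_mem _⟩
  | mul x y _ _ hx hy =>
    obtain ⟨L, rfl, hL⟩ := hx
    obtain ⟨M, rfl, hM⟩ := hy
    exact ⟨L * M, rfl, mul_mem hM hL⟩

theorem exists_inverse_of_mem_WK {n : ℕ} {α : Fin n → V} {K : Set (Fin n)}
    {s : Function.End V} (hs : s ∈ WK α K) : ∃ t ∈ WK α K, s * t = 1 ∧ t * s = 1 := by
  obtain ⟨L, rfl, hL⟩ := exists_isometryEquiv_of_mem_WK hs
  exact ⟨_, hL, funext L.apply_symm_apply, funext L.symm_apply_apply⟩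

theorem WK_mono {n : ℕ} (α : Fin n → V) {K K' : Set (Fin n)} (h : K ⊆ K') :
    WK α K ≤ WK α K' :=
  Submonoid.closure_mono fun _ ⟨k, hk, hg⟩ => ⟨k, h hk, hg⟩

/-- The isometry attached to a word in the simple reflections. -/
def wordEquiv {n : ℕ} (α : Fin n → V) (l : List (Fin n)) : V ≃ₗᵢ[ℝ] V :=
  (l.map fun k => reflEquiv (α k)).prod

theorem wordEquiv_cons {n : ℕ} (α : Fin n → V) (k : Fin n) (l : List (Fin n)) :
    wordEquiv α (k :: l) = reflEquiv (α k) * wordEquiv α l := by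
  simp [wordEquiv]

theorem wordEquiv_concat {n : ℕ} (α : Fin n → V) (l : List (Fin n)) (k : Fin n) :
    wordEquiv α (l ++ [k]) = wordEquiv α l * reflEquiv (α k) := by
  simp [wordEquiv]

theorem exists_word_of_mem_WK {n : ℕ} {α : Fin n → V} {K : Set (Fin n)}
    {s : Function.End V} (hs : s ∈ WK α K) :
    ∃ l : List (Fin n), (∀ k ∈ l, k ∈ K) ∧ ⇑(wordEquiv α l) = s := by
  induction hs using Submonoid.closure_induction with
  | mem x hx =>
    obtain ⟨k, hk, rfl⟩ := hx
    exact ⟨[k], by simpa using hk, by simp [wordEquiv, coe_reflEquiv]⟩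
  | one => exact ⟨[], by simp, rfl⟩
  | mul x y _ _ hx hy =>
    obtain ⟨l, hl, rfl⟩ := hx
    obtain ⟨m, hm, rfl⟩ := hy
    refine ⟨l ++ m, fun k hk => (List.mem_append.1 hk).elim (hl k) (hm k), ?_⟩
    simp only [wordEquiv, List.map_append, List.prod_append]
    rfl

namespace RootSystemData

variable {n : ℕ} (D : RootSystemData V n)

/-- `v` is a nonnegative combination of the simple roots. -/
def Pos (v : V) : Prop := ∃ c : Fin n → ℝ, (∀ i, 0 ≤ c i) ∧ v = ∑ i, c i • D.α i

variable {D}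

theorem Pos.add {v w : V} (hv : D.Pos v) (hw : D.Pos w) : D.Pos (v + w) := by
  obtain ⟨c, hc, rfl⟩ := hv
  obtain ⟨d, hd, rfl⟩ := hw
  exact ⟨fun i => c i + d i, fun i => add_nonneg (hc i) (hd i), by
    simp [add_smul, Finset.sum_add_distrib]⟩

theorem Pos.smul {v : V} {r : ℝ} (hr : 0 ≤ r) (hv : D.Pos v) : D.Pos (r • v) := by
  obtain ⟨c, hc, rfl⟩ := hv
  exact ⟨fun i => r * c i, fun i => mul_nonneg hr (hc i), by simp [mul_smul, Finset.smul_sum]⟩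

theorem coeff_unique {c d : Fin n → ℝ} (h : ∑ i, c i • D.α i = ∑ i, d i • D.α i) : c = d :=
  D.hα_indep.fintypeLinearCombination_injective h

theorem Pos.eq_zero {v : V} (hv : D.Pos v) (hv' : D.Pos (-v)) : v = 0 := by
  obtain ⟨c, hc, rfl⟩ := hv
  obtain ⟨d, hd, h⟩ := hv'
  have : c = fun i => -d i := coeff_unique (D := D) (by simp [← h])
  refine Finset.sum_eq_zero fun i _ => ?_
  have h1 := congrFun this i
  have : c i = 0 := le_antisymm (by linarith [hd i]) (hc i)
  simp [this]

theorem pos_or_neg {β : V} (hβ : β ∈ D.R) : D.Pos β ∨ D.Pos (-β) := by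
  obtain ⟨c, rfl, hc | hc⟩ := D.hα_sign β hβ
  · exact Or.inl ⟨c, hc, rfl⟩
  · exact Or.inr ⟨fun i => -c i, fun i => neg_nonneg.2 (hc i), by simp⟩

theorem pos_simple (i : Fin n) : D.Pos (D.α i) :=
  ⟨Pi.single i 1, fun j => by by_cases h : j = i <;> simp [h], by
    simp [Pi.single_apply, ite_smul]⟩

theorem reflEquiv_mem (i : Fin n) {β : V} (hβ : β ∈ D.R) : reflEquiv (D.α i) β ∈ D.R := by
  rw [coe_reflEquiv]
  exact D.hR_refl _ (D.hα_mem i) ▸ Set.mem_image_of_mem _ hβ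

theorem wordEquiv_mem (l : List (Fin n)) {β : V} (hβ : β ∈ D.R) :
    wordEquiv D.α l β ∈ D.R := by
  induction l with
  | nil => exact hβ
  | cons k l ih => rw [wordEquiv_cons]; exact reflEquiv_mem k ih

theorem mem_R_of_mem_WK {K : Set (Fin n)} {s : Function.End V} (hs : s ∈ WK D.α K)
    {β : V} (hβ : β ∈ D.R) : s β ∈ D.R := by
  obtain ⟨l, -, rfl⟩ := exists_word_of_mem_WK hs
  exact wordEquiv_mem l hβ

/-- A simple reflection can only make a positive root negative if the root is proportional
to the simple root. -/
theorem reflEquiv_eq_of_not_pos {k : Fin n} {β : V} (hβ : β ∈ D.R) (hpos : D.Pos β)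
    (hneg : ¬ D.Pos (reflEquiv (D.α k) β)) : reflEquiv β = reflEquiv (D.α k) := by
  obtain ⟨c, hc, hβc⟩ := hpos
  obtain ⟨d, hd, hβd⟩ := (pos_or_neg (reflEquiv_mem k hβ)).resolve_left hneg
  set t : ℝ := 2 * ⟪β, D.α k⟫ / ⟪D.α k, D.α k⟫
  have hcd : (fun i => c i - (Pi.single k t : Fin n → ℝ) i) = fun i => -d i := by
    apply coeff_unique (D := D)
    simp only [sub_smul, Finset.sum_sub_distrib, neg_smul, Finset.sum_neg_distrib, ← hβd, ← hβc,
      neg_neg, reflEquiv_apply]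
    simp [Pi.single_apply, ite_smul, t]
  have hc0 : ∀ i, i ≠ k → c i = 0 := fun i hi => by
    have h := congrFun hcd i
    simp only [Pi.single_apply, hi, if_false] at h
    linarith [hc i, hd i]
  have hβk : β = c k • D.α k := by
    rw [hβc]
    exact Finset.sum_eq_single k (fun i _ hi => by simp [hc0 i hi]) (by simp)
  have hck : c k ≠ 0 := fun h => D.hR_ne0 β hβ (by rw [hβk, h, zero_smul])
  rw [hβk, reflEquiv_smul hck]

/-- The exchange condition. -/
theorem exchange (l : List (Fin n)) (i : Fin n) (h : ¬ D.Pos (wordEquiv D.α l (D.α i))) :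
    ∃ l' : List (Fin n), l'.length + 1 = l.length ∧ (∀ k ∈ l', k ∈ l) ∧
      wordEquiv D.α l * reflEquiv (D.α i) = wordEquiv D.α l' := by
  induction l with
  | nil => exact absurd (pos_simple i) h
  | cons k l ih =>
    by_cases hl : D.Pos (wordEquiv D.α l (D.α i))
    · refine ⟨l, rfl, fun j hj => List.mem_cons_of_mem _ hj, ?_⟩
      rw [wordEquiv_cons] at h ⊢
      have := reflEquiv_eq_of_not_pos (wordEquiv_mem l (D.hα_mem i)) hl h
      rw [mul_assoc, ← reflEquiv_map, this, ← mul_assoc, reflEquiv_mul_self, one_mul]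
    · obtain ⟨l', hlen, hmem, hl'⟩ := ih hl
      refine ⟨k :: l', by simp [hlen], fun j hj => ?_, ?_⟩
      · rcases List.mem_cons.1 hj with rfl | hj
        · exact List.mem_cons_self
        · exact List.mem_cons_of_mem _ (hmem j hj)
      · rw [wordEquiv_cons, wordEquiv_cons, mul_assoc, hl']

theorem pos_sub_wordEquiv {u : V} (N : ℕ) : ∀ l : List (Fin n), l.length ≤ N →
    (∀ k ∈ l, 0 ≤ ⟪u, D.α k⟫) → D.Pos (u - wordEquiv D.α l u) := by
  induction N with
  | zero =>
    intro l hl _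
    obtain rfl : l = [] := List.length_eq_zero_iff.1 (Nat.le_zero.1 hl)
    exact ⟨0, fun _ => le_rfl, by simp [wordEquiv]⟩
  | succ N ih =>
    intro l hl hu
    rcases List.eq_nil_or_concat l with rfl | ⟨l, k, rfl⟩
    · exact ih [] (Nat.zero_le _) hu
    rw [List.concat_eq_append] at hl hu ⊢
    simp only [List.length_append, List.length_singleton, List.mem_append,
      List.mem_singleton] at hl hu
    have hul : ∀ j ∈ l, 0 ≤ ⟪u, D.α j⟫ := fun j hj => hu j (Or.inl hj)
    by_cases h : D.Pos (wordEquiv D.α l (D.α k))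
    · have hsplit : u - wordEquiv D.α (l ++ [k]) u = (u - wordEquiv D.α l u) +
          (2 * ⟪u, D.α k⟫ / ⟪D.α k, D.α k⟫) • wordEquiv D.α l (D.α k) := by
        rw [wordEquiv_concat]
        change u - wordEquiv D.α l (reflEquiv (D.α k) u) = _
        rw [reflEquiv_apply, map_sub, map_smul]
        abel
      rw [hsplit]
      refine (ih l (by omega) hul).add (h.smul ?_)
      exact div_nonneg (mul_nonneg zero_le_two (hu k (Or.inr rfl))) real_inner_self_nonneg
    · obtain ⟨l', hlen, hmem, hl'⟩ := exchange l k h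
      rw [wordEquiv_concat, hl']
      exact ih l' (by omega) fun j hj => hul j (hmem j hj)

/-- The cone `C_K` meets every `W_K`-orbit in at most one point. -/
theorem eq_of_mem_cham {K : Set (Fin n)} {s : Function.End V} (hs : s ∈ WK D.α K) {u : V}
    (hu : u ∈ cham D.α K) (hsu : s u ∈ cham D.α K) : s u = u := by
  have key : ∀ (t : Function.End V), t ∈ WK D.α K → ∀ v ∈ cham D.α K, D.Pos (v - t v) := by
    intro t ht v hv
    obtain ⟨l, hl, rfl⟩ := exists_word_of_mem_WK ht
    exact pos_sub_wordEquiv _ l le_rfl fun k hk => hv k (hl k hk)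
  obtain ⟨t, ht, -, hts⟩ := exists_inverse_of_mem_WK hs
  have h1 := key s hs u hu
  have h2 := key t ht _ hsu
  rw [show t (s u) = u from congrFun hts u, ← neg_sub] at h2
  exact (sub_eq_zero.1 (h1.eq_zero h2)).symm

variable (D)

theorem finite_WK (K : Set (Fin n)) : (WK D.α K : Set (Function.End V)).Finite := by
  have hfin : (Set.univ.pi fun _ : Fin n => D.R).Finite := Set.Finite.pi fun _ => D.hR_fin
  refine Set.Finite.of_injOn (f := fun s i => s (D.α i)) ?_ ?_ hfin
  · exact fun s hs i _ => mem_R_of_mem_WK hs (D.hα_mem i)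
  · intro s hs t ht hst
    obtain ⟨L, rfl, -⟩ := exists_isometryEquiv_of_mem_WK hs
    obtain ⟨M, rfl, -⟩ := exists_isometryEquiv_of_mem_WK ht
    have : (L : V →ₗ[ℝ] V) = M :=
      LinearMap.ext_on_range D.hα_span fun i => congrFun hst i
    exact funext fun x => LinearMap.congr_fun this x

/-- The cone `C_K` meets every `W_K`-orbit. -/
theorem exists_mem_cham (K : Set (Fin n)) (v : V) : ∃ s ∈ WK D.α K, s v ∈ cham D.α K := by
  let f : V →ₗ[ℝ] ℝ := (Module.Basis.mk D.hα_indep D.hα_span.ge).constr ℝ fun _ => 1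
  have hf : ∀ i, f (D.α i) = 1 := fun i => by
    have := (Module.Basis.mk D.hα_indep D.hα_span.ge).constr_basis ℝ (fun _ => (1 : ℝ)) i
    rwa [Module.Basis.mk_apply] at this
  obtain ⟨s, hs, hmax⟩ := Set.exists_max_image _ (fun s : Function.End V => f (s v))
    (D.finite_WK K) ⟨1, one_mem _⟩
  refine ⟨s, hs, fun k hk => ?_⟩
  by_contra! hneg
  let g : Function.End V := reflMap (D.α k)
  have h := hmax (g * s)
    (mul_mem (Submonoid.subset_closure ⟨k, hk, rfl⟩) hs)
  change f (s v - (2 * ⟪s v, D.α k⟫ / ⟪D.α k, D.α k⟫) • D.α k) ≤ f (s v) at h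
  have hα : 0 < ⟪D.α k, D.α k⟫ := real_inner_self_pos.2 (D.hR_ne0 _ (D.hα_mem k))
  have : 2 * ⟪s v, D.α k⟫ / ⟪D.α k, D.α k⟫ < 0 := div_neg_of_neg_of_pos (by linarith) hα
  rw [map_sub, map_smul, hf, smul_eq_mul] at h
  linarith

end RootSystemData

open Classical in
/-- The projection of the polynomial ring killing the variables of all facets that do not
contain the point `v`. -/
def srProj (Q : Set V) (v : V) :
    MvPolynomial (Facets Q) ℝ →ₐ[ℝ] MvPolynomial (Facets Q) ℝ :=
  MvPolynomial.aeval fun F => if v ∈ F.1 then MvPolynomial.X F else 0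

open Classical in
theorem srProj_X (Q : Set V) (v : V) (F : Facets Q) :
    srProj Q v (MvPolynomial.X F) = if v ∈ F.1 then MvPolynomial.X F else 0 :=
  MvPolynomial.aeval_X _ _

theorem srProj_eq_zero {Q : Set V} (v : V) {p : MvPolynomial (Facets Q) ℝ}
    (hp : p ∈ srIdeal Q) : srProj Q v p = 0 := by
  have h : srIdeal Q ≤ RingHom.ker (srProj Q v) := by
    refine Ideal.span_le.2 ?_
    rintro _ ⟨t, ht, rfl⟩
    have hv : v ∉ ⋂ F ∈ t, (F.1 : Set V) := by simp [ht]
    simp only [Set.mem_iInter, not_forall] at hv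
    obtain ⟨F, hF, hvF⟩ := hv
    change srProj Q v (∏ F ∈ t, MvPolynomial.X F) = 0
    rw [map_prod]
    exact Finset.prod_eq_zero hF (by rw [srProj_X, if_neg hvF])
  exact h hp

theorem coeff_srProj {Q : Set V} {v : V} {m : Facets Q →₀ ℕ} (hm : ∀ F ∈ m.support, v ∈ F.1)
    (p : MvPolynomial (Facets Q) ℝ) : (srProj Q v p).coeff m = p.coeff m := by
  classical
  induction p using MvPolynomial.induction_on' with
  | add p q hp hq => rw [map_add, MvPolynomial.coeff_add, MvPolynomial.coeff_add, hp, hq]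
  | monomial d c =>
    rw [srProj, MvPolynomial.aeval_monomial]
    by_cases hd : ∀ F ∈ d.support, v ∈ F.1
    · rw [Finsupp.prod_congr fun F hF => by rw [if_pos (hd F hF)], MvPolynomial.monomial_eq]
      rfl
    · push Not at hd
      obtain ⟨F, hF, hvF⟩ := hd
      rw [Finsupp.prod, Finset.prod_eq_zero hF, mul_zero, MvPolynomial.coeff_zero,
        MvPolynomial.coeff_monomial, if_neg]
      · rintro rfl
        exact hvF (hm F hF)
      · rw [if_neg hvF, zero_pow (Finsupp.mem_support_iff.1 hF)]

/-- If every nonempty intersection of facets contains a point of `A`, then the Stanley–Reisner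
ideal is the intersection of the kernels of the projections at the points of `A`. -/
theorem mem_srIdeal_of_srProj_eq_zero {Q A : Set V}
    (hA : ∀ t : Finset (Facets Q), (⋂ F ∈ t, (F.1 : Set V)).Nonempty →
      ∃ a ∈ A, ∀ F ∈ t, a ∈ F.1)
    {p : MvPolynomial (Facets Q) ℝ} (hp : ∀ a ∈ A, srProj Q a p = 0) : p ∈ srIdeal Q := by
  rw [p.as_sum]
  refine Ideal.sum_mem _ fun m hm => ?_
  have hempty : (⋂ F ∈ m.support, (F.1 : Set V)) = ∅ := by
    by_contra hne
    obtain ⟨a, ha, haF⟩ := hA _ (Set.nonempty_iff_ne_empty.2 hne)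
    have := coeff_srProj haF p
    rw [hp a ha, MvPolynomial.coeff_zero] at this
    exact MvPolynomial.mem_support_iff.1 hm this.symm
  rw [MvPolynomial.monomial_eq]
  refine Ideal.mul_mem_left _ _ (Ideal.mem_of_dvd _ ?_
    (Ideal.subset_span ⟨m.support, hempty, rfl⟩))
  exact Finset.prod_dvd_prod_of_dvd _ _ fun F hF =>
    dvd_pow_self _ (Finsupp.mem_support_iff.1 hF)

namespace PermSetup

variable {n : ℕ} (S : PermSetup V n)

/-- The `W`-orbit of `Λ`, whose convex hull is `P`. -/
def orbitPoints : Set V := ⋃ w ∈ WK S.α Set.univ, Set.image w S.Λ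

variable {S} {K : Set (Fin n)} {s : Function.End V}

theorem P_eq : S.P = convexHull ℝ S.orbitPoints := rfl

theorem orbitPoints_subset : S.orbitPoints ⊆ S.P := subset_convexHull ℝ _

theorem map_mem_orbitPoints (hs : s ∈ WK S.α K) {v : V} (hv : v ∈ S.orbitPoints) :
    s v ∈ S.orbitPoints := by
  simp only [orbitPoints, Set.mem_iUnion] at hv ⊢
  obtain ⟨w, hw, l, hl, rfl⟩ := hv
  exact ⟨s * w, mul_mem (WK_mono _ (Set.subset_univ K) hs) hw, l, hl, rfl⟩

theorem map_mem_P (hs : s ∈ WK S.α K) {v : V} (hv : v ∈ S.P) : s v ∈ S.P := by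
  obtain ⟨L, rfl, -⟩ := exists_isometryEquiv_of_mem_WK hs
  have h : L '' S.P ⊆ S.P := by
    rw [P_eq]
    have := (L : V →ₗ[ℝ] V).image_convexHull S.orbitPoints
    refine this.subset.trans (convexHull_mono ?_)
    rintro _ ⟨x, hx, rfl⟩
    exact map_mem_orbitPoints hs hx
  exact h ⟨v, hv, rfl⟩

theorem isFacet_image (hs : s ∈ WK S.α K) {F : Set V} (hF : IsFacet S.P F) :
    IsFacet S.P (s '' F) := by
  obtain ⟨L, rfl, hL⟩ := exists_isometryEquiv_of_mem_WK hs
  refine ⟨fun hne => ?_, ?_⟩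
  · obtain ⟨l, hl⟩ := hF.1 hne.of_image
    refine ⟨l.comp (L.symm.toContinuousLinearEquiv : V →L[ℝ] V), ?_⟩
    ext x
    constructor
    · rintro ⟨y, hy, rfl⟩
      rw [hl] at hy
      refine ⟨map_mem_P hs hy.1, fun z hz => ?_⟩
      simpa using hy.2 _ (map_mem_P hL hz)
    · rintro ⟨hx, hmax⟩
      refine ⟨L.symm x, ?_, L.apply_symm_apply x⟩
      rw [hl]
      refine ⟨map_mem_P hL hx, fun z hz => ?_⟩
      simpa using hmax _ (map_mem_P hs hz)
  · have : affineSpan ℝ (L '' F) =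
        (affineSpan ℝ F).map (L.toLinearEquiv : V →ₗ[ℝ] V).toAffineMap := by
      rw [AffineSubspace.map_span]
      rfl
    rw [this, AffineSubspace.map_direction, LinearMap.toAffineMap_linear,
      LinearEquiv.finrank_map_eq]
    exact hF.2

theorem inner_pos_of_mem_cham (hnd : S.Nondegenerate) {v : V} (hv : v ∈ S.orbitPoints)
    (hvK : v ∈ cham S.α K) {k : Fin n} (hk : k ∈ K) : 0 < ⟪v, S.α k⟫ := by
  refine (hvK k hk).lt_of_ne' ?_
  simp only [orbitPoints, Set.mem_iUnion] at hv
  obtain ⟨w, hw, l, hl, rfl⟩ := hv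
  obtain ⟨L, rfl, hL⟩ := exists_isometryEquiv_of_mem_WK hw
  rw [LinearIsometryEquiv.inner_map_eq_flip]
  set β := L.symm (S.α k)
  have hβ : β ∈ S.R := RootSystemData.mem_R_of_mem_WK hL (S.hα_mem k)
  have key : ∀ γ : V, γ ≠ 0 → RootSystemData.Pos S.toRootSystemData γ → 0 < ⟪l, γ⟫ := by
    rintro _ hγ ⟨c, hc, rfl⟩
    simp only [inner_sum, inner_smul_right]
    obtain ⟨i, -, hi⟩ := Finset.exists_ne_zero_of_sum_ne_zero hγ
    refine Finset.sum_pos' (fun j _ => mul_nonneg (hc j) (hnd l hl j).le)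
      ⟨i, Finset.mem_univ _, mul_pos ((hc i).lt_of_ne' ?_) (hnd l hl i)⟩
    rintro h0
    simp [h0] at hi
  have hβ0 := S.hR_ne0 β hβ
  rcases RootSystemData.pos_or_neg hβ with h | h
  · exact (key β hβ0 h).ne'
  · have := key _ (neg_ne_zero.2 hβ0) h
    rw [inner_neg_right] at this
    linarith

/-- A linear form maximized on `P` at a point of `orbitPoints ∩ C_K` lies itself in `C_K`. -/
theorem mem_cham_of_isMax (hnd : S.Nondegenerate) {v : V} (hv : v ∈ S.orbitPoints)
    (hvK : v ∈ cham S.α K) {u : V} (hu : ∀ y ∈ S.P, ⟪u, y⟫ ≤ ⟪u, v⟫) : u ∈ cham S.α K := by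
  intro k hk
  have hmem : reflMap (S.α k) ∈ WK S.α K := Submonoid.subset_closure ⟨k, hk, rfl⟩
  have h := hu _ (orbitPoints_subset (map_mem_orbitPoints hmem hv))
  rw [reflMap, inner_sub_right, inner_smul_right] at h
  have hα : 0 < ⟪S.α k, S.α k⟫ := real_inner_self_pos.2 (S.hR_ne0 _ (S.hα_mem k))
  have hc : 0 < 2 * ⟪v, S.α k⟫ / ⟪S.α k, S.α k⟫ :=
    div_pos (mul_pos two_pos (inner_pos_of_mem_cham hnd hv hvK hk)) hα
  exact nonneg_of_mul_nonneg_right (by linarith) hc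

theorem image_eq_of_mem_cham [FiniteDimensional ℝ V] (hnd : S.Nondegenerate)
    (hs : s ∈ WK S.α K) {F : Set V} (hF : IsFacet S.P F) {v v' : V}
    (hv : v ∈ S.orbitPoints) (hvK : v ∈ cham S.α K) (hvF : v ∈ F)
    (hv' : v' ∈ S.orbitPoints) (hv'K : v' ∈ cham S.α K) (hv'F : v' ∈ s '' F) :
    s '' F = F := by
  obtain ⟨l, hl⟩ := hF.1 ⟨v, hvF⟩
  obtain ⟨u, rfl⟩ := (InnerProductSpace.toDual ℝ V).surjective l
  simp only [InnerProductSpace.toDual_apply_apply] at hl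
  obtain ⟨t, ht, hst, hts⟩ := exists_inverse_of_mem_WK hs
  have hinner : ∀ w ∈ WK S.α K, ∀ x y, ⟪w x, w y⟫ = ⟪x, y⟫ := by
    intro w hw x y
    obtain ⟨L, rfl, -⟩ := exists_isometryEquiv_of_mem_WK hw
    exact L.inner_map_map x y
  have hst' : ∀ y, s (t y) = y := congrFun hst
  have hts' : ∀ y, t (s y) = y := congrFun hts
  have hu : u ∈ cham S.α K := mem_cham_of_isMax hnd hv hvK (hl ▸ hvF).2
  have hsu : s u ∈ cham S.α K := by
    obtain ⟨x, hx, rfl⟩ := hv'F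
    rw [hl] at hx
    refine mem_cham_of_isMax hnd hv' hv'K fun y hy => ?_
    rw [← hst' y, hinner s hs, hinner s hs]
    exact hx.2 _ (map_mem_P ht hy)
  have hfix : s u = u := RootSystemData.eq_of_mem_cham hs hu hsu
  have hsub : ∀ w ∈ WK S.α K, w u = u → ∀ x ∈ F, w x ∈ F := by
    intro w hw hwu x hx
    rw [hl] at hx ⊢
    refine ⟨map_mem_P hw hx.1, fun y hy => ?_⟩
    have : ⟪u, w x⟫ = ⟪u, x⟫ := by
      conv_lhs => rw [← hwu]
      exact hinner w hw u x
    exact (hx.2 y hy).trans_eq this.symm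
  refine Set.Subset.antisymm ?_ fun x hx => ?_
  · rintro _ ⟨x, hx, rfl⟩
    exact hsub s hs hfix x hx
  · refine ⟨t x, hsub t ht ?_ x hx, hst' x⟩
    conv_lhs => rw [← hfix]
    exact hts' u

theorem exists_mem_orbitPoints (t : Finset (Facets S.P))
    (ht : (⋂ F ∈ t, (F.1 : Set V)).Nonempty) :
    ∃ a ∈ S.orbitPoints, ∀ F ∈ t, a ∈ F.1 := by
  obtain ⟨x, hx⟩ := ht
  simp only [Set.mem_iInter] at hx
  rcases t.eq_empty_or_nonempty with rfl | ⟨F₀, hF₀⟩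
  · obtain ⟨l, hl⟩ := S.hΛ_ne
    refine ⟨l, ?_, by simp⟩
    simp only [orbitPoints, Set.mem_iUnion]
    exact ⟨1, one_mem _, l, hl, rfl⟩
  have hex : ∀ F : Facets S.P, ∃ l : StrongDual ℝ V, F ∈ t →
      F.1 = {x ∈ S.P | ∀ y ∈ S.P, l y ≤ l x} := fun F => by
    by_cases hF : F ∈ t
    · exact (F.2.1 ⟨x, hx F hF⟩).imp fun l hl _ => hl
    · exact ⟨0, fun h => absurd h hF⟩
  choose l hl using hex
  have hmax : ∀ F ∈ t, x ∈ S.P ∧ ∀ y ∈ S.P, l F y ≤ l F x := fun F hF => by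
    have := hx F hF
    rwa [hl F hF] at this
  obtain ⟨a, ha, hxa⟩ :=
    ((∑ F ∈ t, (l F : V →ₗ[ℝ] ℝ)).convexOn convex_univ).exists_ge_of_mem_convexHull
      (Set.subset_univ _) (hmax F₀ hF₀).1
  have haP := orbitPoints_subset ha
  simp only [LinearMap.sum_apply, ContinuousLinearMap.coe_coe] at hxa
  have heq : ∀ F ∈ t, l F a = l F x :=
    (Finset.sum_eq_sum_iff_of_le fun F hF => (hmax F hF).2 a haP).1
      (le_antisymm (Finset.sum_le_sum fun F hF => (hmax F hF).2 a haP) hxa)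
  refine ⟨a, ha, fun F hF => ?_⟩
  rw [hl F hF]
  exact ⟨haP, fun y hy => ((hmax F hF).2 y hy).trans_eq (heq F hF).symm⟩

/-- The action of `W_K` on the facets of `P`. -/
def facetMap (s : ↥(WK S.α K)) (F : Facets S.P) : Facets S.P :=
  ⟨(s : Function.End V) '' F.1, isFacet_image s.2 F.2⟩

theorem facetMap_one : facetMap (1 : ↥(WK S.α K)) = id :=
  funext fun F => Subtype.ext (Set.image_id F.1)

theorem facetMap_mul (s t : ↥(WK S.α K)) : facetMap (s * t) = facetMap s ∘ facetMap t :=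
  funext fun F => Subtype.ext (Set.image_comp (s : Function.End V) (t : Function.End V) F.1)

theorem exists_mul_eq_one (s : ↥(WK S.α K)) : ∃ t : ↥(WK S.α K), s * t = 1 ∧ t * s = 1 := by
  obtain ⟨t, ht, hst, hts⟩ := exists_inverse_of_mem_WK s.2
  exact ⟨⟨t, ht⟩, Subtype.ext hst, Subtype.ext hts⟩

theorem leftInverse_facetMap {s t : ↥(WK S.α K)} (h : t * s = 1) :
    Function.LeftInverse (facetMap t) (facetMap s) := fun F => by
  rw [← Function.comp_apply (f := facetMap t), ← facetMap_mul, h, facetMap_one, id]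

theorem facetMap_injective (s : ↥(WK S.α K)) : Function.Injective (facetMap s) := by
  obtain ⟨t, -, hts⟩ := exists_mul_eq_one s
  exact (leftInverse_facetMap hts).injective

theorem srProj_rename (s : ↥(WK S.α K)) (v : V) (p : MvPolynomial (Facets S.P) ℝ) :
    srProj S.P ((s : Function.End V) v) (MvPolynomial.rename (facetMap s) p) =
      MvPolynomial.rename (facetMap s) (srProj S.P v p) := by
  have hinj : Function.Injective (s : Function.End V) := by
    obtain ⟨L, hL, -⟩ := exists_isometryEquiv_of_mem_WK s.2
    rw [← hL]
    exact L.injective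
  refine DFunLike.congr_fun (f := (srProj S.P ((s : Function.End V) v)).comp
    (MvPolynomial.rename (facetMap s))) (g := (MvPolynomial.rename (facetMap s)).comp
    (srProj S.P v)) (MvPolynomial.algHom_ext fun F => ?_) p
  simp only [AlgHom.comp_apply, MvPolynomial.rename_X, srProj_X]
  have : (s : Function.End V) v ∈ (facetMap s F).1 ↔ v ∈ F.1 := hinj.mem_set_image
  by_cases h : v ∈ F.1
  · rw [if_pos h, if_pos (this.2 h), MvPolynomial.rename_X]
  · rw [if_neg h, if_neg (mt this.1 h), map_zero]

theorem srIdeal_le_comap_rename (s : ↥(WK S.α K)) :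
    srIdeal S.P ≤ (srIdeal S.P).comap (MvPolynomial.rename (R := ℝ) (facetMap s)) := by
  intro p hp
  refine mem_srIdeal_of_srProj_eq_zero exists_mem_orbitPoints fun a _ => ?_
  obtain ⟨t, hst, -⟩ := exists_mul_eq_one s
  have ha : (s : Function.End V) ((t : Function.End V) a) = a :=
    congrFun (congrArg Subtype.val hst) a
  rw [← ha]
  exact (srProj_rename s _ p).trans (by rw [srProj_eq_zero _ hp, map_zero])

/-- The endomorphism of the Stanley–Reisner ring induced by an element of `W_K`. -/
def srMap (s : ↥(WK S.α K)) : SRAlg S.P →ₐ[ℝ] SRAlg S.P :=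
  Ideal.quotientMapₐ (srIdeal S.P) (MvPolynomial.rename (facetMap s)) (srIdeal_le_comap_rename s)

theorem srMap_mk (s : ↥(WK S.α K)) (p : MvPolynomial (Facets S.P) ℝ) :
    srMap s (srMk S.P p) = srMk S.P (MvPolynomial.rename (facetMap s) p) := rfl

theorem srMk_surjective (Q : Set V) : Function.Surjective (srMk Q) :=
  Ideal.Quotient.mkₐ_surjective ℝ _

theorem srMap_one : srMap (1 : ↥(WK S.α K)) = AlgHom.id ℝ (SRAlg S.P) := by
  ext a
  obtain ⟨p, rfl⟩ := srMk_surjective _ a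
  rw [srMap_mk, facetMap_one, MvPolynomial.rename_id_apply, AlgHom.id_apply]

theorem srMap_mul (s t : ↥(WK S.α K)) : srMap (s * t) = (srMap s).comp (srMap t) := by
  ext a
  obtain ⟨p, rfl⟩ := srMk_surjective _ a
  rw [AlgHom.comp_apply, srMap_mk, srMap_mk, srMap_mk, facetMap_mul, MvPolynomial.rename_rename]

variable (S K) in
/-- The action of `W_K` on the Stanley–Reisner ring by algebra automorphisms. -/
def srAction : ↥(WK S.α K) →* (SRAlg S.P ≃ₐ[ℝ] SRAlg S.P) where
  toFun s := AlgEquiv.ofAlgHom (srMap s) (srMap (exists_mul_eq_one s).choose)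
    (by rw [← srMap_mul, (exists_mul_eq_one s).choose_spec.1, srMap_one])
    (by rw [← srMap_mul, (exists_mul_eq_one s).choose_spec.2, srMap_one])
  map_one' := AlgEquiv.ext fun a => DFunLike.congr_fun srMap_one a
  map_mul' s t := AlgEquiv.ext fun a => DFunLike.congr_fun (srMap_mul s t) a

theorem srAction_apply (s : ↥(WK S.α K)) (a : SRAlg S.P) : srAction S K s a = srMap s a := rfl

variable (S K) in
/-- The `W_K`-orbit of a facet. -/
def facetOrbit (F : Facets S.P) : Set (Facets S.P) :=
  {F' | ∃ s ∈ WK S.α K, F'.1 = Set.image s F.1}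

theorem finite_facetOrbit (F : Facets S.P) : (facetOrbit S K F).Finite := by
  refine Set.Finite.of_finite_image (f := Subtype.val)
    (((S.finite_WK K).image fun s => s '' F.1).subset ?_) Subtype.val_injective.injOn
  rintro _ ⟨F', ⟨s, hs, h⟩, rfl⟩
  exact ⟨s, hs, h.symm⟩

theorem orbitSum_eq (F : Facets S.P) :
    orbitSum S K F = ∑ F' ∈ (finite_facetOrbit (K := K) F).toFinset, MvPolynomial.X F' := by
  rw [orbitSum, finsum_eq_sum_of_support_subset (s := (finite_facetOrbit (K := K) F).toFinset)]
  · exact Finset.sum_congr rfl fun F' hF' => if_pos ((Set.Finite.mem_toFinset _).1 hF')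
  · intro F' hF'
    rw [Set.Finite.coe_toFinset]
    by_contra h
    exact hF' (if_neg h)

theorem facetMap_mem_facetOrbit (s : ↥(WK S.α K)) {F F' : Facets S.P}
    (h : F' ∈ facetOrbit S K F) : facetMap s F' ∈ facetOrbit S K F := by
  obtain ⟨t, ht, h⟩ := h
  refine ⟨s * t, mul_mem s.2 ht, ?_⟩
  change (s : Function.End V) '' F'.1 = _
  rw [h]
  exact (Set.image_comp (s : Function.End V) t F.1).symm

theorem rename_orbitSum (s : ↥(WK S.α K)) (F : Facets S.P) :
    MvPolynomial.rename (facetMap s) (orbitSum S K F) = orbitSum S K F := by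
  obtain ⟨t, hst, hts⟩ := exists_mul_eq_one s
  rw [orbitSum_eq, map_sum]
  simp only [MvPolynomial.rename_X]
  refine Finset.sum_bij' (fun F' _ => facetMap s F') (fun F' _ => facetMap t F')
    (fun F' h => ?_) (fun F' h => ?_) (fun F' _ => leftInverse_facetMap hts F')
    (fun F' _ => leftInverse_facetMap hst F') (fun _ _ => rfl) <;>
  · rw [Set.Finite.mem_toFinset] at h ⊢
    exact facetMap_mem_facetOrbit _ h

variable (S K) in
open Classical in
/-- Sends the variable of a facet meeting `orbitPoints ∩ C_K` to its orbit sum, and all other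
variables to zero. -/
def retract : MvPolynomial (Facets S.P) ℝ →ₐ[ℝ] MvPolynomial (Facets S.P) ℝ :=
  MvPolynomial.aeval fun F =>
    if ∃ v ∈ S.orbitPoints, v ∈ cham S.α K ∧ v ∈ F.1 then orbitSum S K F else 0

theorem rename_retract (s : ↥(WK S.α K)) (p : MvPolynomial (Facets S.P) ℝ) :
    MvPolynomial.rename (facetMap s) (retract S K p) = retract S K p := by
  refine DFunLike.congr_fun (f := (MvPolynomial.rename (facetMap s)).comp (retract S K))
    (MvPolynomial.algHom_ext fun F => ?_) p
  rw [AlgHom.comp_apply, retract, MvPolynomial.aeval_X]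
  split_ifs
  · exact rename_orbitSum s F
  · exact map_zero _

theorem srMk_retract_mem (p : MvPolynomial (Facets S.P) ℝ) :
    srMk S.P (retract S K p) ∈
      Algebra.adjoin ℝ {a : SRAlg S.P | ∃ F : Facets S.P, a = srMk S.P (orbitSum S K F)} := by
  induction p using MvPolynomial.induction_on with
  | C r => rw [retract, MvPolynomial.aeval_C, AlgHom.commutes]; exact Subalgebra.algebraMap_mem _ r
  | add p q hp hq => rw [map_add, map_add]; exact add_mem hp hq
  | mul_X p F hp =>
    rw [map_mul, map_mul]
    refine mul_mem hp ?_
    rw [retract, MvPolynomial.aeval_X]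
    split_ifs
    · exact Algebra.subset_adjoin ⟨F, rfl⟩
    · rw [map_zero]; exact zero_mem _

theorem srProj_retract [FiniteDimensional ℝ V] (hnd : S.Nondegenerate) {v : V}
    (hv : v ∈ S.orbitPoints) (hvK : v ∈ cham S.α K) (p : MvPolynomial (Facets S.P) ℝ) :
    srProj S.P v (retract S K p) = srProj S.P v p := by
  refine DFunLike.congr_fun (f := (srProj S.P v).comp (retract S K))
    (MvPolynomial.algHom_ext fun F => ?_) p
  rw [AlgHom.comp_apply, retract, MvPolynomial.aeval_X, srProj_X]
  split_ifs with hF hvF hvF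
  · rw [orbitSum_eq, map_sum, Finset.sum_eq_single F]
    · rw [srProj_X, if_pos hvF]
    · intro F' hF' hne
      obtain ⟨s, hs, h⟩ := (Set.Finite.mem_toFinset _).1 hF'
      rw [srProj_X, if_neg]
      intro hvF'
      exact hne (Subtype.ext (h.trans
        (image_eq_of_mem_cham hnd hs F.2 hv hvK hvF hv hvK (h ▸ hvF'))))
    · intro h
      rw [Set.Finite.mem_toFinset] at h
      exact (h ⟨1, one_mem _, (Set.image_id F.1).symm⟩).elim
  · obtain ⟨w, hw, hwK, hwF⟩ := hF
    rw [orbitSum_eq, map_sum]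
    refine Finset.sum_eq_zero fun F' hF' => ?_
    obtain ⟨s, hs, h⟩ := (Set.Finite.mem_toFinset _).1 hF'
    rw [srProj_X, if_neg]
    intro hvF'
    rw [h] at hvF'
    rw [image_eq_of_mem_cham hnd hs F.2 hw hwK hwF hv hvK hvF'] at hvF'
    exact hvF hvF'
  · exact (hF ⟨v, hv, hvK, hvF⟩).elim
  · exact map_zero _

theorem srMk_retract_eq [FiniteDimensional ℝ V] (hnd : S.Nondegenerate)
    {p : MvPolynomial (Facets S.P) ℝ} (hp : srMk S.P p ∈ invariants (srAction S K)) :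
    srMk S.P (retract S K p) = srMk S.P p := by
  refine Eq.symm (Ideal.Quotient.eq.2
    (mem_srIdeal_of_srProj_eq_zero exists_mem_orbitPoints fun a ha => ?_))
  obtain ⟨s, hs, hsa⟩ := S.exists_mem_cham K a
  have hinv : MvPolynomial.rename (facetMap ⟨s, hs⟩) p - p ∈ srIdeal S.P :=
    Ideal.Quotient.eq.1 (hp ⟨s, hs⟩)
  refine MvPolynomial.rename_injective _ (facetMap_injective ⟨s, hs⟩) ?_
  rw [← srProj_rename, map_sub, rename_retract, map_sub, map_zero,
    srProj_retract hnd (map_mem_orbitPoints hs ha) hsa, ← map_sub, srProj_eq_zero _ hinv]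

theorem invariants_srAction [FiniteDimensional ℝ V] (hnd : S.Nondegenerate) (K : Set (Fin n)) :
    invariants (srAction S K) =
      Algebra.adjoin ℝ {a : SRAlg S.P | ∃ F : Facets S.P, a = srMk S.P (orbitSum S K F)} := by
  refine le_antisymm (fun a ha => ?_) (Algebra.adjoin_le ?_)
  · obtain ⟨p, rfl⟩ := srMk_surjective _ a
    rw [← srMk_retract_eq hnd ha]
    exact srMk_retract_mem p
  · rintro _ ⟨F, rfl⟩ s
    rw [srAction_apply, srMap_mk, rename_orbitSum]

end PermSetup

/-- Lemma 4.6(1), stated over `ℝ`: for nondegenerate simple `P`, each `s ∈ W_K`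
permutes the facets of `P` and `W_K` acts on `𝒮ℛ(P)` by renaming variables; the
invariant subalgebra `𝒮ℛ(P)^{W_K}` is generated as an `ℝ`-algebra by the classes of
the orbit sums `∑_{F' ∈ W_K·F} X_{F'}`. -/
theorem statement_14 {V : Type*} [NormedAddCommGroup V] [InnerProductSpace ℝ V]
    [FiniteDimensional ℝ V] {n : ℕ} (S : PermSetup V n)
    (hfull : (interior S.P).Nonempty) (hnd : S.Nondegenerate) (hsimple : IsSimple S.P)
    (K : Set (Fin n)) :
    (∀ s ∈ WK S.α K, ∀ F : Set V, IsFacet S.P F → IsFacet S.P (Set.image s F)) ∧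
    ∃ ρ : ↥(WK S.α K) →* (SRAlg S.P ≃ₐ[ℝ] SRAlg S.P),
      (∀ (s : ↥(WK S.α K)) (F : Facets S.P)
        (hF : IsFacet S.P (Set.image (s : Function.End V) F.1)),
        ρ s (srMk S.P (MvPolynomial.X F)) =
          srMk S.P (MvPolynomial.X ⟨Set.image (s : Function.End V) F.1, hF⟩)) ∧
      invariants ρ =
        Algebra.adjoin ℝ {a : SRAlg S.P | ∃ F : Facets S.P, a = srMk S.P (orbitSum S K F)} := by
  refine ⟨fun s hs F hF => PermSetup.isFacet_image hs hF, PermSetup.srAction S K,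
    fun s F hF => ?_, PermSetup.invariants_srAction hnd K⟩
  rw [PermSetup.srAction_apply, PermSetup.srMap_mk, MvPolynomial.rename_X]
  rfl
end
end

section
/- Lemma (Lemma 4.8; Lemma 10.5 of Abe et al., as proved in the paper). Let F be a field, let A and B be commutative F-algebras with ℕ-gradings 𝒜 and ℬ respectively, and let d ∈ ℕ. Assume 𝒜_i = 0 and ℬ_i = 0 for all i > d, and ℬ_d ≠ 0. Let f : A → B be a surjective F-algebra homomorphism that is graded, i.e. f(𝒜_i) ⊆ ℬ_i for all i. Assume moreover: (a) for every i ≤ d and every nonzero a ∈ 𝒜_i there exists a' ∈ 𝒜_{d−i} with a·a' ≠ 0 (the multiplication pairings 𝒜_i × 𝒜_{d−i} → 𝒜_d are non-degenerate, as in a Poincaré duality algebra); and (b) f is injective on 𝒜_d. Then f is bijective. -/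
/-- A graded algebra homomorphism commutes with taking homogeneous components. -/
theorem map_coe_decompose {F A B : Type*} [Field F] [CommRing A] [Algebra F A]
    [CommRing B] [Algebra F B] (𝒜 : ℕ → Submodule F A) (ℬ : ℕ → Submodule F B)
    [GradedAlgebra 𝒜] [GradedAlgebra ℬ] (f : A →ₐ[F] B)
    (hgraded : ∀ i, ∀ a ∈ 𝒜 i, f a ∈ ℬ i) (a : A) (i : ℕ) :
    f (DirectSum.decompose 𝒜 a i) = DirectSum.decompose ℬ (f a) i := by
  induction a using DirectSum.Decomposition.inductionOn 𝒜 with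
  | zero => simp
  | @homogeneous j m =>
    by_cases h : j = i
    · subst h
      rw [DirectSum.decompose_of_mem_same 𝒜 m.2,
        DirectSum.decompose_of_mem_same ℬ (hgraded j m m.2)]
    · rw [DirectSum.decompose_of_mem_ne 𝒜 m.2 h,
        DirectSum.decompose_of_mem_ne ℬ (hgraded j m m.2) h, map_zero]
  | add m m' h h' => simp [DirectSum.decompose_add, h, h']


/-- Lemma 4.8 (Lemma 10.5 of Abe et al.): a surjective graded `F`-algebra homomorphism
from a Poincaré-duality-type graded algebra of top degree `d` that is injective in
top degree is bijective. -/
theorem statement_15 {F A B : Type*} [Field F] [CommRing A] [Algebra F A]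
    [CommRing B] [Algebra F B]
    (𝒜 : ℕ → Submodule F A) (ℬ : ℕ → Submodule F B)
    [GradedAlgebra 𝒜] [GradedAlgebra ℬ]
    (d : ℕ)
    (hAtop : ∀ i, d < i → 𝒜 i = ⊥)
    (hBtop : ∀ i, d < i → ℬ i = ⊥)
    (hBd : ℬ d ≠ ⊥)
    (f : A →ₐ[F] B) (hsurj : Function.Surjective f)
    (hgraded : ∀ i, ∀ a ∈ 𝒜 i, f a ∈ ℬ i)
    (hpd : ∀ i, i ≤ d → ∀ a ∈ 𝒜 i, a ≠ 0 → ∃ a' ∈ 𝒜 (d - i), a * a' ≠ 0)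
    (hinj : ∀ a ∈ 𝒜 d, ∀ a' ∈ 𝒜 d, f a = f a' → a = a') :
    Function.Bijective f := by
  refine ⟨(injective_iff_map_eq_zero f).2 fun a ha => ?_, hsurj⟩
  have homogeneous_eq_zero : ∀ i, ∀ x ∈ 𝒜 i, f x = 0 → x = 0 := by
    intro i x hx hfx
    by_contra hne
    by_cases hi : i ≤ d
    · obtain ⟨y, hy, hxy⟩ := hpd i hi x hx hne
      have hmem : x * y ∈ 𝒜 d := by
        simpa [Nat.add_sub_cancel' hi] using SetLike.mul_mem_graded hx hy
      exact hxy (hinj _ hmem 0 (zero_mem _) (by simp [hfx]))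
    · rw [hAtop i (not_le.1 hi)] at hx
      exact hne ((Submodule.mem_bot F).1 hx)
  apply (DirectSum.decompose 𝒜).injective
  ext i
  rw [DirectSum.decompose_zero, homogeneous_eq_zero i _ (SetLike.coe_mem _)
    (by rw [map_coe_decompose 𝒜 ℬ f hgraded, ha]; simp)]
  simp
end
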